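/- arXiv:math/9209206 — 2 statements merged into one kernel-verified Lean document; each statement's English description precedes it below -/
import Mathlib

section
/- There exists a projection from 𝔸″ onto the Cohen partial order ℂ: a map h : 𝔸″ → ℂ such that (i) if p ≤ q in 𝔸″ then h(p) ≤ h(q) in ℂ; (ii) for every p ∈ 𝔸″ and every t ∈ ℂ with t ≤ h(p), there exists q ≤ p in 𝔸″ with h(q) ≤ t; and (iii) for every s ∈ ℂ there is p ∈ 𝔸″ with h(p) ≤ s. -/
open MeasureTheory

noncomputable section

/-- The binary-digit map sending `r ∈ [0,1)` to its sequence of binary digits,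
so `binDigits r n` is the `n`-th binary digit of `r`. -/
def binDigits (r : ℝ) : ℕ → Bool := fun n => decide (⌊r * 2 ^ (n + 1)⌋ % 2 = 1)

/-- The uniform product ("coin-flipping") probability measure `μ` on Cantor space `2^ω`,
realized as the pushforward of Lebesgue measure on `[0,1)` under the binary-digit map. -/
def μC : Measure (ℕ → Bool) := (volume.restrict (Set.Ico (0 : ℝ) 1)).map binDigits

/-- The basic clopen cylinder `[σ]` determined by a finite binary string `σ`. -/
def cyl (σ : List Bool) : Set (ℕ → Bool) :=
  {f | ∀ i : ℕ, ∀ h : i < σ.length, f i = σ.get ⟨i, h⟩}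

/-- Property (*): for every binary string `σ` of length `i` not in `φ i`, the union of the
cylinders determined by proper extensions of `σ` appearing in some `φ j`, `j > i`,
has measure `< 2^{-i}`. -/
def StarProperty (φ : ℕ → Set (List Bool)) : Prop :=
  ∀ i : ℕ, ∀ σ : List Bool, σ.length = i → σ ∉ φ i →
    μC (⋃ τ ∈ {τ : List Bool | σ <+: τ ∧ σ ≠ τ ∧ ∃ j, i < j ∧ τ ∈ φ j}, cyl τ)
      < (1 / 2 : ENNReal) ^ i

/-- A condition `(u, φ)` of the partial order `𝔸′`: `φ` assigns to each `i` a set of binary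
strings of length `i`, satisfies (*), the union of all the corresponding cylinders has measure
`< 1/2`, and `u = φ↾n` is a finite initial segment of `φ` (represented by its domain `n`). -/
structure APrime where
  /-- the domain of the finite initial segment `u` (so `u = φ↾n`) -/
  n : ℕ
  /-- the function `φ` -/
  φ : ℕ → Set (List Bool)
  hlen : ∀ i : ℕ, ∀ σ ∈ φ i, σ.length = i
  hstar : StarProperty φ
  hmeas : μC (⋃ i, ⋃ σ ∈ φ i, cyl σ) < 1 / 2

/-- The order of `𝔸′`: `(u,φ) ≤ (v,ψ)` iff `u ⊇ v` and every string in some `ψ i` extends a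
string in some `φ j` with `j ≤ i`. -/
def APrimeLe (p q : APrime) : Prop :=
  q.n ≤ p.n ∧ (∀ i < q.n, p.φ i = q.φ i) ∧
    ∀ i : ℕ, ∀ σ ∈ q.φ i, ∃ j ≤ i, ∃ τ ∈ p.φ j, τ <+: σ

/-- Membership in the suborder `𝔸″ ⊆ 𝔸′`.  (The inequalities `μ > 1/2 - 2^{-m}` and
`μ ≤ 1/2 - 2^{-m}` are stated additively as `μ + 2^{-m} > 1/2`, resp. `≤`, to express
real-number subtraction faithfully in `ℝ≥0∞`.) -/
def InAPP (p : APrime) : Prop :=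
  ∃ m : ℕ,
    1 / 2 < μC (⋃ i < p.n, ⋃ σ ∈ p.φ i, cyl σ) + (1 / 2 : ENNReal) ^ m ∧
    μC (⋃ i < p.n - 1, ⋃ σ ∈ p.φ i, cyl σ) + (1 / 2 : ENNReal) ^ m ≤ 1 / 2 ∧
    μC (⋃ i, ⋃ _ : p.n ≤ i, ⋃ σ ∈ p.φ i, cyl σ) < (1 / 2 : ENNReal) ^ (m + 7)

/-- The order of the Cohen partial order `ℂ` (finite sequences of naturals):
`s ≤ t` iff `t` is an initial segment of `s`. -/
def CohenLe (s t : List ℕ) : Prop := t <+: s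

/-! ### Cylinders and their measure -/

/-- The restriction of `f` to its first `k` values. -/
def initialSegment (f : ℕ → Bool) (k : ℕ) : List Bool := (List.range k).map f

lemma length_initialSegment (f : ℕ → Bool) (k : ℕ) : (initialSegment f k).length = k := by
  simp [initialSegment]

lemma mem_cyl_iff {f : ℕ → Bool} {σ : List Bool} :
    f ∈ cyl σ ↔ initialSegment f σ.length = σ := by
  constructor
  · intro h
    apply List.ext_getElem
    · simp [initialSegment]
    · intro i h1 h2
      simpa [initialSegment] using h i h2
  · intro h i hi
    have : (initialSegment f σ.length)[i]'(by simpa [initialSegment] using hi) = σ[i] := by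
      simp only [h]
    simpa [initialSegment] using this

lemma mem_cyl_initialSegment (f : ℕ → Bool) (k : ℕ) : f ∈ cyl (initialSegment f k) := by
  rw [mem_cyl_iff, length_initialSegment]

lemma initialSegment_prefix (f : ℕ → Bool) {j k : ℕ} (h : j ≤ k) :
    initialSegment f j <+: initialSegment f k := by
  obtain ⟨d, rfl⟩ := Nat.exists_eq_add_of_le h
  rw [initialSegment, initialSegment, List.range_add, List.map_append]
  exact List.prefix_append _ _

lemma prefix_of_mem_cyl {f : ℕ → Bool} {σ τ : List Bool} (hσ : f ∈ cyl σ) (hτ : f ∈ cyl τ)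
    (h : σ.length ≤ τ.length) : σ <+: τ := by
  rw [mem_cyl_iff] at hσ hτ
  rw [← hσ, ← hτ]
  exact initialSegment_prefix f h

lemma cyl_subset_of_prefix {σ τ : List Bool} (h : σ <+: τ) : cyl τ ⊆ cyl σ := by
  intro f hf
  have hpre := prefix_of_mem_cyl (mem_cyl_initialSegment f σ.length) hf
    (by rw [length_initialSegment]; exact h.length_le)
  rw [mem_cyl_iff]
  exact (List.prefix_of_prefix_length_le hpre h (by rw [length_initialSegment])).eq_of_length
    (length_initialSegment f _)

lemma measurableSet_cyl (σ : List Bool) : MeasurableSet (cyl σ) := by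
  have : cyl σ = ⋂ i : Fin σ.length, (fun f : ℕ → Bool => f i) ⁻¹' {σ.get i} := by
    ext f
    simp [cyl, Fin.forall_iff]
  rw [this]
  exact MeasurableSet.iInter fun i => measurable_pi_apply _ (measurableSet_singleton _)

lemma measurable_binDigits : Measurable binDigits := by
  refine measurable_pi_lambda _ fun n => ?_
  have h : Measurable fun r : ℝ => ⌊r * 2 ^ (n + 1)⌋ := (measurable_id.mul_const _).floor
  exact (measurable_from_top (f := fun z : ℤ => decide (z % 2 = 1))).comp h

lemma mem_cyl_concat {f : ℕ → Bool} {σ : List Bool} {b : Bool} :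
    f ∈ cyl (σ ++ [b]) ↔ f ∈ cyl σ ∧ f σ.length = b := by
  rw [mem_cyl_iff, mem_cyl_iff]
  simp [initialSegment, List.range_succ]

lemma floor_mul_two_pow_succ_div (r : ℝ) (n : ℕ) :
    ⌊r * 2 ^ (n + 1)⌋ / 2 = ⌊r * 2 ^ n⌋ := by
  have h := Int.floor_div_natCast (r * 2 ^ (n + 1)) 2
  push_cast at h
  rw [← h]
  congr 1
  rw [pow_succ]
  ring

lemma exists_floor_iff_binDigits_mem_cyl (σ : List Bool) :
    ∃ v : ℤ, ∀ r : ℝ, (r ∈ Set.Ico (0 : ℝ) 1 ∧ binDigits r ∈ cyl σ) ↔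
      ⌊r * 2 ^ σ.length⌋ = v := by
  induction σ using List.reverseRecOn with
  | nil =>
    refine ⟨0, fun r => ?_⟩
    simp [cyl, Int.floor_eq_zero_iff]
  | append_singleton σ b ih =>
    obtain ⟨v, hv⟩ := ih
    refine ⟨2 * v + (if b then 1 else 0), fun r => ?_⟩
    rw [mem_cyl_concat, ← and_assoc, hv, List.length_append, List.length_singleton,
      ← floor_mul_two_pow_succ_div]
    cases b <;> simp [binDigits] <;> omega

lemma μC_cyl (σ : List Bool) : μC (cyl σ) = (1 / 2 : ENNReal) ^ σ.length := by
  obtain ⟨v, hv⟩ := exists_floor_iff_binDigits_mem_cyl σ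
  rw [μC, Measure.map_apply measurable_binDigits (measurableSet_cyl σ),
    Measure.restrict_apply (measurable_binDigits (measurableSet_cyl σ))]
  have hpos : (0 : ℝ) < 2 ^ σ.length := by positivity
  have : binDigits ⁻¹' cyl σ ∩ Set.Ico 0 1
      = Set.Ico ((v : ℝ) / 2 ^ σ.length) ((v + 1) / 2 ^ σ.length) := by
    ext r
    rw [Set.mem_inter_iff, and_comm, Set.mem_preimage, hv, Int.floor_eq_iff, Set.mem_Ico,
      div_le_iff₀ hpos, lt_div_iff₀ hpos]
  rw [this, Real.volume_Ico, ← sub_div, add_sub_cancel_left, ← one_div_pow,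
    ENNReal.ofReal_pow (by norm_num), ENNReal.ofReal_div_of_pos (by norm_num)]
  simp

instance : IsFiniteMeasure μC := by
  unfold μC
  infer_instance

/-- Picking one child of each string of length `k` covers half of the space. -/
lemma μC_iUnion_child (k : ℕ) (b : List Bool → Bool) :
    μC (⋃ v : List.Vector Bool k, cyl (v.1 ++ [b v.1])) = 1 / 2 := by
  rw [measure_iUnion]
  · simp only [μC_cyl, List.length_append, List.length_singleton]
    rw [tsum_fintype, Finset.sum_congr rfl fun v _ => by rw [v.2], Finset.sum_const,
      Finset.card_univ, card_vector, Fintype.card_bool, nsmul_eq_mul, pow_succ, ← mul_assoc,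
      Nat.cast_pow, Nat.cast_ofNat, ← mul_pow]
    rw [one_div, ENNReal.mul_inv_cancel (by norm_num) (by norm_num), one_pow, one_mul]
  · intro v w hvw
    refine Set.disjoint_left.mpr fun f hv hw => hvw (Subtype.ext ?_)
    have hv' := mem_cyl_iff.mp (mem_cyl_concat.mp hv).1
    have hw' := mem_cyl_iff.mp (mem_cyl_concat.mp hw).1
    rw [v.2] at hv'
    rw [w.2] at hw'
    exact hv'.symm.trans hw'
  · exact fun v => measurableSet_cyl _

/-- A finite family of small cylinders can be thinned out so that adding it to `B` crosses the
threshold `c` only slightly. -/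
lemma exists_subset_crossing (B : Set (ℕ → Bool)) (c ε : ENNReal) (hB : μC B ≤ c)
    (F : Finset (List Bool)) (hε : ∀ σ ∈ F, μC (cyl σ) ≤ ε)
    (hF : c < μC (B ∪ ⋃ σ ∈ F, cyl σ)) :
    ∃ S ⊆ F, c < μC (B ∪ ⋃ σ ∈ S, cyl σ) ∧ μC (B ∪ ⋃ σ ∈ S, cyl σ) ≤ c + ε := by
  classical
  induction F using Finset.induction_on with
  | empty => simp at hF; exact absurd hF (not_lt.mpr hB)
  | insert a F _ ih =>
    by_cases h : c < μC (B ∪ ⋃ σ ∈ F, cyl σ)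
    · obtain ⟨S, hS, h'⟩ := ih (fun σ hσ => hε σ (Finset.mem_insert_of_mem hσ)) h
      exact ⟨S, hS.trans (Finset.subset_insert _ _), h'⟩
    · refine ⟨insert a F, subset_rfl, hF, ?_⟩
      rw [Finset.set_biUnion_insert, Set.union_left_comm, Set.union_comm]
      exact (measure_union_le _ _).trans
        (add_le_add (not_lt.mp h) (hε a (Finset.mem_insert_self _ _)))

/-! ### The coded sequence -/

/-- Level `i` of `φ` contains a string properly extending a string of an earlier level. -/
def RedundantLevel (φ : ℕ → Set (List Bool)) (i : ℕ) : Prop :=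
  ∃ σ ∈ φ i, ∃ j < i, ∃ τ ∈ φ j, τ <+: σ

open Classical in
/-- The sequence of naturals coded by the redundant levels of `φ` below `n`: such a level `i`
contributes the first component of the pair coded by `i`. -/
def redundancyCode (φ : ℕ → Set (List Bool)) : ℕ → List ℕ
  | 0 => []
  | n + 1 => if RedundantLevel φ n then redundancyCode φ n ++ [(Nat.unpair n).1]
      else redundancyCode φ n

lemma RedundantLevel.congr {φ ψ : ℕ → Set (List Bool)} {i : ℕ} (h : ∀ j ≤ i, φ j = ψ j) :
    RedundantLevel φ i ↔ RedundantLevel ψ i := by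
  unfold RedundantLevel
  rw [h i le_rfl]
  refine exists_congr fun σ => and_congr_right fun _ => exists_congr fun j =>
    and_congr_right fun hj => ?_
  rw [h j hj.le]

lemma redundancyCode_congr {φ ψ : ℕ → Set (List Bool)} {n : ℕ} (h : ∀ j < n, φ j = ψ j) :
    redundancyCode φ n = redundancyCode ψ n := by
  induction n with
  | zero => rfl
  | succ n ih =>
    simp only [redundancyCode]
    rw [ih fun j hj => h j (by omega)]
    have hred : RedundantLevel φ n ↔ RedundantLevel ψ n :=
      RedundantLevel.congr fun j hj => h j (by omega)
    by_cases hφ : RedundantLevel φ n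
    · rw [if_pos hφ, if_pos (hred.mp hφ)]
    · rw [if_neg hφ, if_neg (hφ ∘ hred.mpr)]

lemma redundancyCode_prefix (φ : ℕ → Set (List Bool)) {n n' : ℕ} (h : n ≤ n') :
    redundancyCode φ n <+: redundancyCode φ n' := by
  induction n', h using Nat.le_induction with
  | base => exact List.prefix_rfl
  | succ k _ ih =>
    simp only [redundancyCode]
    split_ifs
    · exact ih.trans (List.prefix_append _ _)
    · exact ih

lemma redundancyCode_eq_of_not_redundant {φ : ℕ → Set (List Bool)} {n n' : ℕ} (h : n ≤ n')
    (hφ : ∀ i, n ≤ i → i < n' → ¬ RedundantLevel φ i) :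
    redundancyCode φ n' = redundancyCode φ n := by
  induction n', h using Nat.le_induction with
  | base => rfl
  | succ k hk ih =>
    simp only [redundancyCode]
    rw [if_neg (hφ k hk (by omega)), ih fun i hi hik => hφ i hi (by omega)]

/-! ### Pruning redundant strings -/

/-- Remove from levels `≥ n` of `φ` the strings that extend a string of an earlier level. -/
def prune (n : ℕ) (φ : ℕ → Set (List Bool)) : ℕ → Set (List Bool) :=
  fun i => {σ ∈ φ i | n ≤ i → ∀ j < i, ∀ τ ∈ φ j, ¬ τ <+: σ}

lemma prune_subset (n : ℕ) (φ : ℕ → Set (List Bool)) (i : ℕ) : prune n φ i ⊆ φ i :=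
  fun _ h => h.1

lemma prune_eq_of_lt {n i : ℕ} (φ : ℕ → Set (List Bool)) (h : i < n) : prune n φ i = φ i := by
  ext σ
  exact ⟨fun h => h.1, fun hσ => ⟨hσ, fun hn => absurd h (not_lt.mpr hn)⟩⟩

lemma exists_prefix_mem_prune (n : ℕ) {φ : ℕ → Set (List Bool)} (i : ℕ) :
    ∀ σ ∈ φ i, ∃ j ≤ i, ∃ τ ∈ prune n φ j, τ <+: σ := by
  induction i using Nat.strong_induction_on with
  | _ i ih =>
    intro σ hσ
    by_cases h : ∃ j < i, ∃ τ ∈ φ j, τ <+: σ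
    · obtain ⟨j, hj, τ, hτ, hτσ⟩ := h
      obtain ⟨l, hl, χ, hχ, hχτ⟩ := ih j hj τ hτ
      exact ⟨l, hl.trans hj.le, χ, hχ, hχτ.trans hτσ⟩
    · push Not at h
      exact ⟨i, le_rfl, σ, ⟨hσ, fun _ => h⟩, List.prefix_rfl⟩

lemma not_redundantLevel_prune {n i : ℕ} {φ : ℕ → Set (List Bool)} (h : n ≤ i) :
    ¬ RedundantLevel (prune n φ) i := by
  rintro ⟨σ, hσ, j, hj, τ, hτ, hτσ⟩
  exact hσ.2 h j hj τ hτ.1 hτσ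

lemma StarProperty.prune {φ : ℕ → Set (List Bool)} (h : StarProperty φ) (n : ℕ) :
    StarProperty (prune n φ) := by
  intro i σ hσ hσn
  by_cases hσφ : σ ∈ φ i
  · have hex : n ≤ i ∧ ∃ j < i, ∃ τ ∈ φ j, τ <+: σ := by
      by_contra hcon
      refine hσn ⟨hσφ, fun hn j hj τ hτ hτσ => hcon ⟨hn, j, hj, τ, hτ, hτσ⟩⟩
    obtain ⟨hn, j, hj, τ, hτ, hτσ⟩ := hex
    have : {χ : List Bool | σ <+: χ ∧ σ ≠ χ ∧ ∃ j, i < j ∧ χ ∈ _root_.prune n φ j} = ∅ := by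
      ext χ
      simp only [Set.mem_ofPred_eq, Set.mem_empty_iff_false, iff_false]
      rintro ⟨h1, -, l, hl, hχ⟩
      exact hχ.2 (by omega) j (by omega) τ hτ (hτσ.trans h1)
    rw [this, Set.biUnion_empty, measure_empty]
    exact ENNReal.pow_pos (by norm_num) _
  · refine lt_of_le_of_lt (measure_mono ?_) (h i σ hσ hσφ)
    refine Set.biUnion_subset_biUnion_left ?_
    rintro χ ⟨h1, h2, l, hl, hχ⟩
    exact ⟨h1, h2, l, hl, hχ.1⟩

/-- The part of Cantor space covered by the levels `≥ k` of the pruned function becomes small. -/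
lemma tendsto_μC_tail_prune (n : ℕ) {φ : ℕ → Set (List Bool)}
    (hlen : ∀ i, ∀ σ ∈ φ i, σ.length = i) :
    Filter.Tendsto (fun k => μC (⋃ i, ⋃ _ : k ≤ i, ⋃ σ ∈ prune n φ i, cyl σ))
      Filter.atTop (nhds 0) := by
  set W : ℕ → Set (ℕ → Bool) := fun k => ⋃ i, ⋃ _ : k ≤ i, ⋃ σ ∈ prune n φ i, cyl σ with hW
  have hmem : ∀ k f, f ∈ W k ↔ ∃ i, k ≤ i ∧ ∃ σ ∈ prune n φ i, f ∈ cyl σ := by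
    intro k f
    simp [hW]
  have hempty : ⋂ k, W k = ∅ := by
    refine Set.eq_empty_of_forall_notMem fun f hf => ?_
    rw [Set.mem_iInter] at hf
    obtain ⟨i, hi, σ, hσ, hfσ⟩ := (hmem _ _).mp (hf n)
    obtain ⟨j, hj, τ, hτ, hfτ⟩ := (hmem _ _).mp (hf (i + 1))
    refine hτ.2 (by omega) i (by omega) σ hσ.1 (prefix_of_mem_cyl hfσ hfτ ?_)
    rw [hlen i σ hσ.1, hlen j τ hτ.1]
    omega
  have hmeas : ∀ k, NullMeasurableSet (W k) μC := fun k =>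
    (MeasurableSet.iUnion fun i => MeasurableSet.iUnion fun _ =>
      MeasurableSet.biUnion (Set.to_countable _) fun σ _ => measurableSet_cyl σ).nullMeasurableSet
  have hanti : Antitone W := by
    intro k l hkl f hf
    obtain ⟨i, hi, h⟩ := (hmem _ _).mp hf
    exact (hmem _ _).mpr ⟨i, hkl.trans hi, h⟩
  have := tendsto_measure_iInter_atTop hmeas hanti ⟨0, measure_ne_top _ _⟩
  rwa [hempty, measure_empty] at this

/-! ### Adding strings at one level -/

open Classical in
/-- The child of `σ` that lies in `φ`, if there is one: `true` when `σ ++ [true]` does,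
`false` otherwise. -/
def preferredChild (φ : ℕ → Set (List Bool)) (σ : List Bool) : Bool :=
  decide (σ ++ [true] ∈ φ (σ.length + 1))

/-- Add to level `i` of `φ` the strings in `S`. -/
def addLevel (φ : ℕ → Set (List Bool)) (i : ℕ) (S : Set (List Bool)) : ℕ → Set (List Bool) :=
  Function.update φ i (φ i ∪ S)

lemma addLevel_self (φ : ℕ → Set (List Bool)) (i : ℕ) (S : Set (List Bool)) :
    addLevel φ i S i = φ i ∪ S := by
  simp [addLevel]

lemma addLevel_of_ne {φ : ℕ → Set (List Bool)} {i j : ℕ} (S : Set (List Bool)) (h : j ≠ i) :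
    addLevel φ i S j = φ j := by
  simp [addLevel, h]

lemma subset_addLevel (φ : ℕ → Set (List Bool)) (i j : ℕ) (S : Set (List Bool)) :
    φ j ⊆ addLevel φ i S j := by
  by_cases h : j = i
  · subst h
    rw [addLevel_self]
    exact Set.subset_union_left
  · rw [addLevel_of_ne S h]

/-- If `σ` is not in `φ`, then (*) leaves its non-preferred child out of `φ`. -/
lemma StarProperty.not_preferredChild_notMem {φ : ℕ → Set (List Bool)} (h : StarProperty φ)
    {σ : List Bool} (hσ : σ ∉ φ σ.length) :
    σ ++ [!preferredChild φ σ] ∉ φ (σ.length + 1) := by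
  by_cases ht : σ ++ [true] ∈ φ (σ.length + 1)
  · intro hf
    simp only [preferredChild, ht, decide_true, Bool.not_true] at hf
    refine absurd (h _ σ rfl hσ) (not_lt.mpr ?_)
    rw [← μC_cyl]
    refine measure_mono fun f hfσ => ?_
    refine Set.mem_biUnion (x := σ ++ [f σ.length]) ⟨List.prefix_append _ _, by simp,
      σ.length + 1, by omega, ?_⟩ (mem_cyl_concat.mpr ⟨hfσ, rfl⟩)
    cases f σ.length
    · exact hf
    · exact ht
  · simp [preferredChild, ht]

/-- Adding preferred children at one level preserves (*). -/
lemma StarProperty.addLevel {φ : ℕ → Set (List Bool)} (h : StarProperty φ)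
    (hlen : ∀ i, ∀ σ ∈ φ i, σ.length = i) (k : ℕ) {S : Set (List Bool)}
    (hS : ∀ τ ∈ S, ∃ σ : List Bool, σ.length = k ∧ τ = σ ++ [preferredChild φ σ]) :
    StarProperty (addLevel φ (k + 1) S) := by
  intro j ρ hρ hρψ
  have hρφ : ρ ∉ φ j := fun hmem => hρψ (subset_addLevel _ _ _ _ hmem)
  by_cases hjk : k + 1 ≤ j
  · refine lt_of_le_of_lt (measure_mono (Set.biUnion_subset_biUnion_left ?_)) (h j ρ hρ hρφ)
    rintro τ ⟨h1, h2, l, hl, hτ⟩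
    rw [addLevel_of_ne S (by omega)] at hτ
    exact ⟨h1, h2, l, hl, hτ⟩
  obtain ⟨f, hfρ, hfU⟩ : ∃ f ∈ cyl ρ, f ∉
      ⋃ τ ∈ {τ : List Bool | ρ <+: τ ∧ ρ ≠ τ ∧ ∃ l, j < l ∧ τ ∈ φ l}, cyl τ := by
    by_contra! hcon
    refine absurd (h j ρ hρ hρφ) (not_lt.mpr ?_)
    rw [← hρ, ← μC_cyl]
    subst hρ
    exact measure_mono hcon
  set σ := initialSegment f k
  have hσlen : σ.length = k := length_initialSegment f k
  have hfσ : f ∈ cyl σ := mem_cyl_initialSegment f k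
  have hρσ : ρ <+: σ := prefix_of_mem_cyl hfρ hfσ (by omega)
  have huncov : ∀ l, j < l → ∀ τ ∈ φ l, ρ <+: τ → ¬ τ <+: σ := by
    intro l hl τ hτ hρτ hτσ
    refine hfU (Set.mem_biUnion (x := τ) ⟨hρτ, ?_, l, hl, hτ⟩ (cyl_subset_of_prefix hτσ hfσ))
    rintro rfl
    have := hlen l _ hτ
    omega
  have hσφ : σ ∉ φ σ.length := by
    intro hmem
    by_cases hjk' : j = k
    · have : ρ = σ := hρσ.eq_of_length (by omega)
      rw [← this, hρ] at hmem
      exact hρφ hmem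
    · exact huncov _ (by omega) σ hmem hρσ List.prefix_rfl
  set χ := σ ++ [!preferredChild φ σ] with hχ
  have hχlen : χ.length = k + 1 := by simp [hχ, hσlen]
  have hχφ : χ ∉ φ (k + 1) := hσlen ▸ h.not_preferredChild_notMem hσφ
  have hχψ : χ ∉ _root_.addLevel φ (k + 1) S (k + 1) := by
    rw [addLevel_self]
    rintro (hmem | hmem)
    · exact hχφ hmem
    · obtain ⟨σ', hσ', heq⟩ := hS _ hmem
      obtain ⟨h1, h2⟩ := List.append_inj heq (by omega)
      rw [h1] at h2
      simp at h2
  have hχρ : cyl χ ⊆ cyl ρ := cyl_subset_of_prefix (hρσ.trans (List.prefix_append _ _))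
  set V := ⋃ τ ∈ {τ : List Bool | χ <+: τ ∧ χ ≠ τ ∧ ∃ l, k + 1 < l ∧ τ ∈ φ l}, cyl τ
  have hVlt : μC V < μC (cyl χ) := by
    rw [μC_cyl, hχlen]
    exact h _ χ hχlen hχφ
  have hsub : (⋃ τ ∈ {τ : List Bool | ρ <+: τ ∧ ρ ≠ τ ∧
      ∃ l, j < l ∧ τ ∈ _root_.addLevel φ (k + 1) S l}, cyl τ) ⊆ (cyl ρ \ cyl χ) ∪ V := by
    refine Set.iUnion₂_subset ?_
    rintro τ ⟨hρτ, hne, l, hl, hτ⟩ g hg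
    by_cases hgχ : g ∈ cyl χ
    · right
      have hτlen : τ.length = l := by
        by_cases hlk : l = k + 1
        · subst hlk
          rw [addLevel_self] at hτ
          rcases hτ with hτ | hτ
          · exact hlen _ _ hτ
          · obtain ⟨σ', hσ', rfl⟩ := hS _ hτ
            simp [hσ']
        · rw [addLevel_of_ne S hlk] at hτ
          exact hlen _ _ hτ
      rcases lt_trichotomy l (k + 1) with hlk | hlk | hlk
      · rw [addLevel_of_ne S hlk.ne] at hτ
        have hgσ : g ∈ cyl σ := cyl_subset_of_prefix (List.prefix_append _ _) hgχ
        exact absurd (prefix_of_mem_cyl hg hgσ (by omega)) (huncov l hl τ hτ hρτ)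
      · subst hlk
        have : τ = χ := (prefix_of_mem_cyl hg hgχ (by omega)).eq_of_length (by omega)
        exact absurd (this ▸ hτ) hχψ
      · rw [addLevel_of_ne S hlk.ne'] at hτ
        refine Set.mem_biUnion (x := τ)
          ⟨prefix_of_mem_cyl hgχ hg (by omega), ?_, l, hlk, hτ⟩ hg
        rintro heq
        rw [← heq] at hτlen
        omega
    · exact Or.inl ⟨cyl_subset_of_prefix hρτ hg, hgχ⟩
  calc _ ≤ μC ((cyl ρ \ cyl χ) ∪ V) := measure_mono hsub
    _ ≤ μC (cyl ρ \ cyl χ) + μC V := measure_union_le _ _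
    _ < μC (cyl ρ \ cyl χ) + μC (cyl χ) :=
        ENNReal.add_lt_add_left (measure_ne_top _ _) hVlt
    _ = μC (cyl ρ) := by
        rw [measure_sdiff hχρ (measurableSet_cyl _).nullMeasurableSet (measure_ne_top _ _),
          tsub_add_cancel_of_le (measure_mono hχρ)]
    _ = _ := by rw [μC_cyl, hρ]

/-! ### The projection -/

/-- The working part of a condition in `𝔸″` contains a string. -/
lemma InAPP.exists_mem {p : APrime} (h : InAPP p) : ∃ j < p.n, ∃ ρ, ρ ∈ p.φ j := by
  obtain ⟨m, h1, h2, -⟩ := h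
  by_contra! hcon
  have hempty : (⋃ i < p.n, ⋃ σ ∈ p.φ i, cyl σ) = ∅ := by
    simp only [Set.iUnion_eq_empty]
    exact fun i hi σ hσ => absurd hσ (hcon i hi σ)
  rw [hempty, measure_empty, zero_add] at h1
  exact absurd (h1.trans_le (le_add_self.trans h2)) (lt_irrefl _)

/-- Every condition in `𝔸″` has an extension coding exactly one more prescribed number. -/
lemma exists_le_redundancyCode_eq {p : APrime} (hp : InAPP p) (a : ℕ) :
    ∃ q : APrime, InAPP q ∧ APrimeLe q p ∧
      redundancyCode q.φ q.n = redundancyCode p.φ p.n ++ [a] := by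
  obtain ⟨j₀, hj₀, ρ, hρ⟩ := hp.exists_mem
  set φ := prune p.n p.φ with hφ
  have hlen : ∀ i, ∀ σ ∈ φ i, σ.length = i := fun i σ hσ => p.hlen i σ (prune_subset _ _ _ hσ)
  have hstar : StarProperty φ := p.hstar.prune _
  set M := μC (⋃ i, ⋃ σ ∈ φ i, cyl σ)
  have hMlt : M < 1 / 2 := lt_of_le_of_lt (measure_mono (Set.iUnion_mono fun i =>
    Set.biUnion_subset_biUnion_left (prune_subset _ _ _))) p.hmeas
  have htend : Filter.Tendsto (fun m : ℕ => (1 / 2 : ENNReal) ^ m) Filter.atTop (nhds 0) :=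
    ENNReal.tendsto_pow_atTop_nhds_zero_of_lt_one (by norm_num)
  obtain ⟨m, hm⟩ : ∃ m : ℕ, (1 / 2 : ENNReal) ^ m < 1 / 2 - M :=
    (htend.eventually_lt_const (tsub_pos_of_lt hMlt)).exists
  have hm_le : (1 / 2 : ENNReal) ^ m ≤ 1 / 2 := hm.le.trans tsub_le_self
  have hpow_pos : ∀ l : ℕ, (0 : ENNReal) < (1 / 2 : ENNReal) ^ l := fun l =>
    ENNReal.pow_pos (by norm_num) l
  set c : ENNReal := 1 / 2 - (1 / 2 : ENNReal) ^ m
  have hcm : c + (1 / 2 : ENNReal) ^ m = 1 / 2 := tsub_add_cancel_of_le hm_le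
  have hMc : M ≤ c := by
    refine ENNReal.le_sub_of_add_le_right (ne_top_of_le_ne_top (by norm_num) hm_le) ?_
    exact (add_le_add_right hm.le M).trans (add_tsub_cancel_of_le hMlt.le).le
  have hc_lt : c < 1 / 2 := ENNReal.sub_lt_self (by norm_num) (by norm_num) (hpow_pos m).ne'
  obtain ⟨N₀, hN₀⟩ := Filter.eventually_atTop.mp
    ((tendsto_μC_tail_prune p.n p.hlen).eventually_lt_const (hpow_pos (m + 7)))
  obtain ⟨N, hNa, hN⟩ : ∃ N, (Nat.unpair N).1 = a ∧ N₀ + p.n + m + 2 ≤ N :=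
    ⟨Nat.pair a (N₀ + p.n + m + 2), by simp, Nat.right_le_pair _ _⟩
  obtain ⟨k, rfl⟩ : ∃ k, N = k + 1 := ⟨N - 1, by omega⟩
  set B := ⋃ i < k + 2, ⋃ σ ∈ φ i, cyl σ with hB
  have hBM : μC B ≤ M :=
    measure_mono (Set.iUnion_mono fun i => Set.iUnion_subset fun _ => subset_rfl)
  set F : Finset (List Bool) := Finset.univ.image
    (fun v : List.Vector Bool k => v.1 ++ [preferredChild φ v.1])
  have hFmem : ∀ τ ∈ F, ∃ σ : List Bool, σ.length = k ∧ τ = σ ++ [preferredChild φ σ] := by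
    intro τ hτ
    obtain ⟨v, -, rfl⟩ := Finset.mem_image.mp hτ
    exact ⟨v.1, v.2, rfl⟩
  have hFlen : ∀ τ ∈ F, τ.length = k + 1 := by
    intro τ hτ
    obtain ⟨σ, hσ, rfl⟩ := hFmem τ hτ
    simp [hσ]
  have hFμ : c < μC (B ∪ ⋃ σ ∈ F, cyl σ) := by
    refine hc_lt.trans_le ((μC_iUnion_child k (preferredChild φ)).symm.le.trans (measure_mono ?_))
    refine Set.iUnion_subset fun v => Set.subset_union_of_subset_right ?_ _
    exact Set.subset_biUnion_of_mem (u := cyl)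
      (show v.1 ++ [preferredChild φ v.1] ∈ F from Finset.mem_image_of_mem _ (Finset.mem_univ v))
  obtain ⟨S, hSF, hS1, hS2⟩ := exists_subset_crossing B c ((1 / 2) ^ (k + 1)) (hBM.trans hMc) F
    (fun τ hτ => by rw [μC_cyl, hFlen τ hτ]) hFμ
  have hρφ : ρ ∈ φ j₀ := by rwa [hφ, prune_eq_of_lt _ hj₀]
  have hρlen : ρ.length = j₀ := hlen _ _ hρφ
  set σ₀ := ρ ++ List.replicate (k - j₀) false with hσ₀
  have hσ₀len : σ₀.length = k := by
    rw [hσ₀, List.length_append, List.length_replicate]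
    omega
  set r := σ₀ ++ [preferredChild φ σ₀]
  have hρr : ρ <+: r := (List.prefix_append _ _).trans (List.prefix_append _ _)
  set T : Set (List Bool) := insert r (S : Set (List Bool))
  have hTmem : ∀ τ ∈ T, ∃ σ : List Bool, σ.length = k ∧ τ = σ ++ [preferredChild φ σ] := by
    rintro τ (rfl | hτ)
    · exact ⟨σ₀, hσ₀len, rfl⟩
    · exact hFmem τ (hSF hτ)
  set ψ := addLevel φ (k + 1) T with hψ
  have hψlen : ∀ i, ∀ σ ∈ ψ i, σ.length = i := by
    intro i σ hσ
    by_cases hi : i = k + 1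
    · subst hi
      rw [hψ, addLevel_self] at hσ
      rcases hσ with hσ | hσ
      · exact hlen _ _ hσ
      · obtain ⟨σ', hσ', rfl⟩ := hTmem σ hσ
        simp [hσ']
    · rw [hψ, addLevel_of_ne T hi] at hσ
      exact hlen _ _ hσ
  have hψlt : ∀ i, i < k + 1 → ψ i = φ i := fun i hi => addLevel_of_ne T hi.ne
  have hψgt : ∀ i, k + 1 < i → ψ i = φ i := fun i hi => addLevel_of_ne T hi.ne'
  have hψB : (⋃ i < k + 2, ⋃ σ ∈ ψ i, cyl σ) = B ∪ ⋃ σ ∈ S, cyl σ := by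
    apply Set.Subset.antisymm
    · refine Set.iUnion₂_subset fun i hi => Set.iUnion₂_subset fun σ hσ => ?_
      have hBsub : ∀ l < k + 2, ∀ τ ∈ φ l, cyl τ ⊆ B := fun l hl τ hτ f hf => by
        simp only [hB, Set.mem_iUnion]
        exact ⟨l, hl, τ, hτ, hf⟩
      by_cases hik : i = k + 1
      · subst hik
        rw [hψ, addLevel_self] at hσ
        rcases hσ with hσ | rfl | hσ
        · exact Set.subset_union_of_subset_left (hBsub _ hi _ hσ) _
        · exact Set.subset_union_of_subset_left
            ((cyl_subset_of_prefix hρr).trans (hBsub j₀ (by omega) ρ hρφ)) _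
        · exact Set.subset_union_of_subset_right (Set.subset_biUnion_of_mem (u := cyl) hσ) _
      · rw [hψlt i (by omega)] at hσ
        exact Set.subset_union_of_subset_left (hBsub _ hi _ hσ) _
    · refine Set.union_subset ?_ (Set.iUnion₂_subset fun σ hσ f hf => ?_)
      · exact Set.iUnion₂_mono fun i hi =>
          Set.biUnion_subset_biUnion_left (subset_addLevel _ _ _ _)
      · simp only [Set.mem_iUnion]
        refine ⟨k + 1, by omega, σ, ?_, hf⟩
        rw [hψ, addLevel_self]
        exact Or.inr (Or.inr hσ)
  have hψtail : μC (⋃ i, ⋃ _ : k + 2 ≤ i, ⋃ σ ∈ ψ i, cyl σ) < (1 / 2 : ENNReal) ^ (m + 7) := by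
    have heq : (⋃ i, ⋃ _ : k + 2 ≤ i, ⋃ σ ∈ ψ i, cyl σ)
        = ⋃ i, ⋃ _ : k + 2 ≤ i, ⋃ σ ∈ φ i, cyl σ :=
      Set.iUnion₂_congr fun i hi => by rw [hψgt i (by omega)]
    rw [heq]
    exact hN₀ (k + 2) (by omega)
  have hanti : ∀ {x y : ℕ}, x ≤ y → (1 / 2 : ENNReal) ^ y ≤ (1 / 2 : ENNReal) ^ x := fun h =>
    pow_le_pow_of_le_one (by norm_num) (by norm_num) h
  have hψmeas : μC (⋃ i, ⋃ σ ∈ ψ i, cyl σ) < 1 / 2 := by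
    have hsub : (⋃ i, ⋃ σ ∈ ψ i, cyl σ) ⊆ (B ∪ ⋃ σ ∈ S, cyl σ) ∪
        ⋃ i, ⋃ _ : k + 2 ≤ i, ⋃ σ ∈ ψ i, cyl σ := by
      rw [← hψB]
      refine Set.iUnion_subset fun i => ?_
      rcases lt_or_ge i (k + 2) with hi | hi
      · exact Set.subset_union_of_subset_left
          (Set.subset_iUnion₂ (s := fun i (_ : i < k + 2) => ⋃ σ ∈ ψ i, cyl σ) i hi) _
      · exact Set.subset_union_of_subset_right
          (Set.subset_iUnion₂ (s := fun i (_ : k + 2 ≤ i) => ⋃ σ ∈ ψ i, cyl σ) i hi) _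
    calc μC (⋃ i, ⋃ σ ∈ ψ i, cyl σ)
        ≤ μC (B ∪ ⋃ σ ∈ S, cyl σ) + μC (⋃ i, ⋃ _ : k + 2 ≤ i, ⋃ σ ∈ ψ i, cyl σ) :=
          (measure_mono hsub).trans (measure_union_le _ _)
      _ < μC (B ∪ ⋃ σ ∈ S, cyl σ) + (1 / 2 : ENNReal) ^ (m + 7) :=
          ENNReal.add_lt_add_left (measure_ne_top _ _) hψtail
      _ ≤ (c + (1 / 2) ^ (m + 1)) + (1 / 2 : ENNReal) ^ (m + 1) :=
          add_le_add (hS2.trans (add_le_add_right (hanti (by omega)) c)) (hanti (by omega))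
      _ = c + (1 / 2) ^ m := by
          rw [add_assoc, pow_succ, ← mul_add, ENNReal.add_halves, mul_one]
      _ = 1 / 2 := hcm
  refine ⟨⟨k + 2, ψ, hψlen, hstar.addLevel hlen k hTmem, hψmeas⟩, ⟨m, ?_, ?_, hψtail⟩,
    ⟨?_, ?_, ?_⟩, ?_⟩
  · change 1 / 2 < μC (⋃ i < k + 2, ⋃ σ ∈ ψ i, cyl σ) + _
    rw [hψB]
    calc (1 / 2 : ENNReal) = c + (1 / 2) ^ m := hcm.symm
      _ < _ := ENNReal.add_lt_add_right (ne_top_of_le_ne_top (by norm_num) hm_le) hS1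
  · change μC (⋃ i < k + 1, ⋃ σ ∈ ψ i, cyl σ) + _ ≤ _
    refine (add_le_add_left (le_trans (measure_mono ?_) hMc) _).trans hcm.le
    exact Set.iUnion_mono fun i => Set.iUnion_subset fun hi => by rw [hψlt i hi]
  · change p.n ≤ k + 2
    omega
  · intro i hi
    change ψ i = p.φ i
    rw [hψlt i (by omega), hφ, prune_eq_of_lt _ hi]
  · intro i σ hσ
    obtain ⟨j, hj, τ, hτ, hτσ⟩ := exists_prefix_mem_prune p.n i σ hσ
    exact ⟨j, hj, τ, subset_addLevel _ _ _ _ hτ, hτσ⟩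
  · change redundancyCode ψ (k + 2) = _
    have hred : RedundantLevel ψ (k + 1) := by
      refine ⟨r, ?_, j₀, by omega, ρ, subset_addLevel _ _ _ _ hρφ, hρr⟩
      rw [hψ, addLevel_self]
      exact Or.inr (Or.inl rfl)
    rw [redundancyCode, if_pos hred, hNa, redundancyCode_congr hψlt,
      redundancyCode_eq_of_not_redundant (n := p.n) (by omega)
        fun i hi _ => not_redundantLevel_prune hi,
      redundancyCode_congr fun j hj => prune_eq_of_lt p.φ hj]

/-- Every condition in `𝔸″` has an extension whose code continues by a prescribed sequence. -/
lemma exists_le_redundancyCode_append {p : APrime} (hp : InAPP p) (l : List ℕ) :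
    ∃ q : APrime, InAPP q ∧ APrimeLe q p ∧
      redundancyCode q.φ q.n = redundancyCode p.φ p.n ++ l := by
  induction l using List.reverseRecOn with
  | nil => exact ⟨p, hp, ⟨le_rfl, fun _ _ => rfl, fun i σ hσ => ⟨i, le_rfl, σ, hσ,
      List.prefix_rfl⟩⟩, by simp⟩
  | append_singleton l a ih =>
    obtain ⟨q, hq, ⟨hqn, hqφ, hqc⟩, hcode⟩ := ih
    obtain ⟨q', hq', ⟨hqn', hqφ', hqc'⟩, hcode'⟩ := exists_le_redundancyCode_eq hq a
    refine ⟨q', hq', ⟨hqn.trans hqn', fun i hi => ?_, fun i σ hσ => ?_⟩, ?_⟩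
    · rw [hqφ' i (hi.trans_le hqn), hqφ i hi]
    · obtain ⟨j, hj, τ, hτ, hτσ⟩ := hqc i σ hσ
      obtain ⟨j', hj', τ', hτ', hττ'⟩ := hqc' j τ hτ
      exact ⟨j', hj'.trans hj, τ', hτ', hττ'.trans hτσ⟩
    · rw [hcode', hcode, List.append_assoc]

/-- The function whose only string is `00`. -/
def singleString : ℕ → Set (List Bool) := fun i => {σ | i = 2 ∧ σ = [false, false]}

lemma μC_lt_of_subset_cyl {X : Set (ℕ → Bool)} {i : ℕ} (hX : X ⊆ cyl [false, false])
    (hi : i < 2) : μC X < (1 / 2 : ENNReal) ^ i := by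
  refine (measure_mono hX).trans_lt ?_
  rw [μC_cyl]
  simp only [one_div, ENNReal.inv_pow.symm]
  rw [ENNReal.inv_lt_inv]
  exact_mod_cast Nat.pow_lt_pow_right one_lt_two hi

lemma starProperty_singleString : StarProperty singleString := by
  intro i σ hσ _
  by_cases hi : i < 2
  · refine μC_lt_of_subset_cyl (Set.iUnion₂_subset ?_) hi
    rintro τ ⟨-, -, j, -, -, rfl⟩
    exact subset_rfl
  · have : {τ : List Bool | σ <+: τ ∧ σ ≠ τ ∧ ∃ j, i < j ∧ τ ∈ singleString j} = ∅ := by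
      ext τ
      simp only [Set.mem_ofPred_eq, Set.mem_empty_iff_false, iff_false]
      rintro ⟨-, -, j, hj, hj2, -⟩
      omega
    rw [this, Set.biUnion_empty, measure_empty]
    exact ENNReal.pow_pos (by norm_num) _

lemma exists_inAPP : ∃ p : APrime, InAPP p ∧ redundancyCode p.φ p.n = [] := by
  refine ⟨⟨3, singleString, ?_, starProperty_singleString, ?_⟩, ⟨1, ?_, ?_, ?_⟩, ?_⟩
  · rintro i σ ⟨rfl, rfl⟩
    rfl
  · have := μC_lt_of_subset_cyl (i := 1) (X := ⋃ i, ⋃ σ ∈ singleString i, cyl σ)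
      (Set.iUnion_subset fun i => Set.iUnion₂_subset fun σ ⟨_, hσ⟩ => hσ ▸ subset_rfl) (by omega)
    simpa using this
  · change 1 / 2 < μC (⋃ i < 3, ⋃ σ ∈ singleString i, cyl σ) + _
    rw [pow_one, add_comm]
    refine ENNReal.lt_add_right (by norm_num) (ne_of_gt ?_)
    refine lt_of_lt_of_le ?_ (measure_mono (μ := μC) (s := cyl [false, false]) fun f hf => ?_)
    · rw [μC_cyl]
      exact ENNReal.pow_pos (by norm_num) _
    · simp only [Set.mem_iUnion]
      exact ⟨2, by omega, _, ⟨rfl, rfl⟩, hf⟩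
  · change μC (⋃ i < 2, ⋃ σ ∈ singleString i, cyl σ) + _ ≤ _
    have : (⋃ i < 2, ⋃ σ ∈ singleString i, cyl σ) = ∅ := by
      simp only [Set.iUnion_eq_empty]
      rintro i hi σ ⟨rfl, -⟩
      omega
    rw [this, measure_empty, zero_add, pow_one]
  · change μC (⋃ i, ⋃ _ : 3 ≤ i, ⋃ σ ∈ singleString i, cyl σ) < _
    have : (⋃ i, ⋃ _ : 3 ≤ i, ⋃ σ ∈ singleString i, cyl σ) = ∅ := by
      simp only [Set.iUnion_eq_empty]
      rintro i hi σ ⟨rfl, -⟩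
      omega
    rw [this, measure_empty]
    exact ENNReal.pow_pos (by norm_num) _
  · refine redundancyCode_eq_of_not_redundant (n := 0) (Nat.zero_le _) ?_
    rintro i - - ⟨σ, ⟨rfl, -⟩, j, hj, τ, ⟨rfl, -⟩, -⟩
    omega

/-- There is a projection `h` from `𝔸″` onto the Cohen partial order `ℂ`. -/
theorem exists_projection_APP_to_Cohen :
    ∃ h : {p : APrime // InAPP p} → List ℕ,
      (∀ p q : {p : APrime // InAPP p}, APrimeLe p.1 q.1 → CohenLe (h p) (h q)) ∧
      (∀ p : {p : APrime // InAPP p}, ∀ t : List ℕ, CohenLe t (h p) →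
        ∃ q : {p : APrime // InAPP p}, APrimeLe q.1 p.1 ∧ CohenLe (h q) t) ∧
      (∀ s : List ℕ, ∃ p : {p : APrime // InAPP p}, CohenLe (h p) s) := by
  refine ⟨fun p => redundancyCode p.1.φ p.1.n, fun p q hpq => ?_, fun p t ht => ?_, fun s => ?_⟩
  · change redundancyCode q.1.φ q.1.n <+: redundancyCode p.1.φ p.1.n
    rw [← redundancyCode_congr hpq.2.1]
    exact redundancyCode_prefix _ hpq.1
  · obtain ⟨l, rfl⟩ := ht
    obtain ⟨q, hq, hqp, hcode⟩ := exists_le_redundancyCode_append p.2 l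
    exact ⟨⟨q, hq⟩, hqp, hcode ▸ List.prefix_rfl⟩
  · obtain ⟨p, hp, hnil⟩ := exists_inAPP
    obtain ⟨q, hq, -, hcode⟩ := exists_le_redundancyCode_append hp s
    rw [hnil, List.nil_append] at hcode
    exact ⟨⟨q, hq⟩, hcode ▸ List.prefix_rfl⟩

end
end

section
/- There is no complete embedding of the localization partial order 𝕃 into the Amoeba partial order 𝔸: there is no map e : 𝕃 → 𝔸 such that (i) p′ ≤ p implies e(p′) ≤ e(p); (ii) if p′ and p are incompatible in 𝕃 then e(p′) and e(p) are incompatible in 𝔸; and (iii) for every A ∈ 𝔸 there is a reduction p ∈ 𝕃 such that for every p′ ≤ p in 𝕃, e(p′) is compatible with A in 𝔸. -/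
open MeasureTheory

noncomputable section

/-- A condition of the Amoeba partial order `𝔸`: an open subset of `2^ω` of measure `< 1/2`. -/
def Amoeba : Type := {A : Set (ℕ → Bool) // IsOpen A ∧ μC A < 1 / 2}

/-- The Amoeba order: `A ≤ B` iff `B ⊆ A`. -/
def AmoebaLe (p q : Amoeba) : Prop := q.1 ⊆ p.1

/-- A condition of the localization partial order `𝕃`: a pair `(σ, G)` where `σ` is a finite
sequence of finite sets of naturals with `|σ(i)| = i + 1`, and `G` is a finite set of functions
`ℕ → ℕ` with `|G| ≤ |σ| + 1`. -/
structure LCond where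
  /-- the finite sequence of finite "slaloms" -/
  σ : List (Finset ℕ)
  /-- the finite set of functions to be localized -/
  G : Finset (ℕ → ℕ)
  hσ : ∀ i : ℕ, ∀ h : i < σ.length, (σ.get ⟨i, h⟩).card = i + 1
  hG : G.card ≤ σ.length + 1

/-- The order of `𝕃`: `(σ,G) ≤ (τ,H)` iff `σ ⊇ τ`, `G ⊇ H`, and `g(i) ∈ σ(i)` for every
`g ∈ H` and every `i` with `|τ| ≤ i < |σ|`. -/
def LLe (p q : LCond) : Prop :=
  q.σ <+: p.σ ∧ q.G ⊆ p.G ∧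
    ∀ g ∈ q.G, ∀ i : ℕ, q.σ.length ≤ i → ∀ h : i < p.σ.length, g i ∈ p.σ.get ⟨i, h⟩

/-- The condition `(⟨⟩, {f})` of `𝕃` with empty sequence and a single function. -/
def LCond.single (f : ℕ → ℕ) : LCond :=
  ⟨[], {f}, fun i h => absurd h (by simp), by simp⟩

/-- In a second countable space with a finite Borel measure, any uncountable family of open sets
has a member which is approximated in measure from outside by infinitely many others. -/
lemma exists_infinite_measure_diff_lt {X Ω : Type*} [Uncountable X] [TopologicalSpace Ω]
    [SecondCountableTopology Ω] [MeasurableSpace Ω] [BorelSpace Ω] (μ : Measure Ω)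
    [IsFiniteMeasure μ] (A : X → Set Ω) (hA : ∀ x, IsOpen (A x)) :
    ∃ x, ∀ ε : ENNReal, 0 < ε → {y | μ (A y \ A x) < ε}.Infinite := by
  classical
  by_contra! hfin
  choose ε hε hfinite using hfin
  choose n hn using fun x => ENNReal.exists_inv_nat_lt (hε x).ne'
  have happrox : ∀ x, ∃ t : Finset (TopologicalSpace.countableBasis Ω),
      (⋃ u ∈ t, (u : Set Ω)) ⊆ A x ∧ μ (A x \ ⋃ u ∈ t, (u : Set Ω)) < (n x : ENNReal)⁻¹ := by
    intro x
    let B : Finset (TopologicalSpace.countableBasis Ω) → Set Ω :=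
      fun t => ⋃ u ∈ t.filter (fun u : TopologicalSpace.countableBasis Ω => (u : Set Ω) ⊆ A x),
        (u : Set Ω)
    have hBmeas : ∀ t, MeasurableSet (B t) := fun t =>
      Finset.measurableSet_biUnion _ fun u _ =>
        (TopologicalSpace.isOpen_of_mem_countableBasis u.2).measurableSet
    have hmono : Antitone fun t => A x \ B t := by
      intro s t hst
      refine Set.sdiff_subset_sdiff_right (Set.biUnion_subset_biUnion_left ?_)
      exact Finset.filter_subset_filter _ hst
    have hempty : ⋂ t, A x \ B t = ∅ := by
      refine Set.eq_empty_of_forall_notMem fun z hz => ?_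
      rw [Set.mem_iInter] at hz
      obtain ⟨u, hu, hzu, huA⟩ :=
        (TopologicalSpace.isBasis_countableBasis Ω).exists_subset_of_mem_open (hz ∅).1 (hA x)
      refine (hz {⟨u, hu⟩}).2 (Set.mem_biUnion (x := ⟨u, hu⟩) ?_ hzu)
      simpa using huA
    have htend := tendsto_measure_iInter_atTop (μ := μ)
      (fun t => ((hA x).measurableSet.diff (hBmeas t)).nullMeasurableSet) hmono
      ⟨∅, measure_ne_top _ _⟩
    rw [hempty, measure_empty] at htend
    have hpos : (0 : ENNReal) < (n x : ENNReal)⁻¹ :=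
      ENNReal.inv_pos.2 (ENNReal.natCast_ne_top _)
    obtain ⟨t, ht⟩ := (htend.eventually_lt_const hpos).exists
    refine ⟨t.filter (fun u : TopologicalSpace.countableBasis Ω => (u : Set Ω) ⊆ A x), ?_, ht⟩
    exact Set.iUnion₂_subset fun u hu => (Finset.mem_filter.1 hu).2
  choose t htA htμ using happrox
  have : Countable (TopologicalSpace.countableBasis Ω) :=
    (TopologicalSpace.countable_countableBasis Ω).to_subtype
  refine not_countable (α := X) ?_
  rw [← Set.countable_univ_iff]
  have hcover : (Set.univ : Set X) = ⋃ c, (fun x => (n x, t x)) ⁻¹' {c} := by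
    ext x; simp
  rw [hcover]
  refine Set.countable_iUnion fun c => ?_
  rcases Set.eq_empty_or_nonempty ((fun x => (n x, t x)) ⁻¹' {c}) with h | ⟨x, hx⟩
  · simp [h]
  · refine ((hfinite x).subset fun y hy => ?_).countable
    have hxy : (n y, t y) = (n x, t x) := hy.trans hx.symm
    obtain ⟨hnxy, htxy⟩ := Prod.ext_iff.1 hxy
    simp only at hnxy htxy
    calc μ (A y \ A x) ≤ μ (A y \ ⋃ u ∈ t y, (u : Set Ω)) :=
          measure_mono (Set.sdiff_subset_sdiff_right (htxy ▸ htA x))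
      _ < (n y : ENNReal)⁻¹ := htμ y
      _ < ε x := hnxy ▸ hn x

/-- If each of an uncountable family of open sets has measure below `c`, then there are arbitrarily
large finite subfamilies with all members inside a single open set of measure below `c`. -/
lemma exists_isOpen_measure_lt_forall_exists_finset {X Ω : Type*} [Uncountable X]
    [TopologicalSpace Ω] [SecondCountableTopology Ω] [MeasurableSpace Ω] [BorelSpace Ω]
    (μ : Measure Ω) [IsFiniteMeasure μ] (A : X → Set Ω) (hA : ∀ x, IsOpen (A x)) (c : ENNReal)
    (hc : ∀ x, μ (A x) < c) :
    ∃ U : Set Ω, IsOpen U ∧ μ U < c ∧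
      ∀ k : ℕ, ∃ F : Finset X, F.card = k ∧ ∀ x ∈ F, A x ⊆ U := by
  obtain ⟨x, hx⟩ := exists_infinite_measure_diff_lt μ A hA
  obtain ⟨δ, hδ, hδsum⟩ :=
    ENNReal.exists_pos_sum_of_countable' (tsub_pos_of_lt (hc x)).ne' ℕ
  have hbudget : ∀ k : ℕ, 0 < δ k / k := fun k =>
    ENNReal.div_pos (hδ k).ne' (ENNReal.natCast_ne_top k)
  choose F hFsub hFcard using fun k => (hx _ (hbudget k)).exists_subset_card_eq k
  refine ⟨A x ∪ ⋃ k, ⋃ y ∈ F k, A y, ?_, ?_, fun k => ⟨F k, hFcard k, fun y hy => ?_⟩⟩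
  · exact (hA x).union (isOpen_iUnion fun k => isOpen_biUnion fun y _ => hA y)
  · have hF : ∀ k, μ (⋃ y ∈ F k, A y \ A x) ≤ δ k := fun k =>
      calc μ (⋃ y ∈ F k, A y \ A x) ≤ ∑ y ∈ F k, μ (A y \ A x) :=
            measure_biUnion_finset_le _ _
        _ ≤ ∑ _y ∈ F k, δ k / k := Finset.sum_le_sum fun y hy => (hFsub k hy).le
        _ = k * (δ k / k) := by rw [Finset.sum_const, hFcard, nsmul_eq_mul]
        _ ≤ δ k := ENNReal.mul_div_le
    calc μ (A x ∪ ⋃ k, ⋃ y ∈ F k, A y)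
        = μ (A x ∪ ⋃ k, ⋃ y ∈ F k, A y \ A x) := by
          rw [← Set.union_sdiff_self]; simp only [Set.iUnion_sdiff]
      _ ≤ μ (A x) + μ (⋃ k, ⋃ y ∈ F k, A y \ A x) := measure_union_le _ _
      _ ≤ μ (A x) + ∑' k, δ k := by
          gcongr
          exact (measure_iUnion_le _).trans (ENNReal.tsum_le_tsum hF)
      _ < c := by rw [add_comm]; exact lt_tsub_iff_right.1 hδsum
  · exact fun z hz => Or.inr (Set.mem_iUnion.2 ⟨k, Set.mem_biUnion hy hz⟩)

/-- The function `n ↦ x ↾ n`, with finite binary strings coded by natural numbers. -/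
def initialSegmentCode (x : ℕ → Bool) (n : ℕ) : ℕ :=
  Encodable.encode (fun i : Fin n => x i)

/-- The functions `initialSegmentCode x` are pairwise eventually different. -/
lemma eventually_initialSegmentCode_ne {x y : ℕ → Bool} (h : x ≠ y) :
    ∀ᶠ n in Filter.atTop, initialSegmentCode x n ≠ initialSegmentCode y n := by
  obtain ⟨m, hm⟩ := Function.ne_iff.1 h
  filter_upwards [Filter.eventually_gt_atTop m] with n hn heq
  exact hm (congrFun (Encodable.encode_injective heq) ⟨m, hn⟩)

lemma eventually_injOn_initialSegmentCode (F : Finset (ℕ → Bool)) :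
    ∀ᶠ n in Filter.atTop, Set.InjOn (fun x => initialSegmentCode x n) F := by
  have : ∀ᶠ n in Filter.atTop, ∀ x ∈ F, ∀ y ∈ F,
      x ≠ y → initialSegmentCode x n ≠ initialSegmentCode y n := by
    simp only [Filter.eventually_all_finset, Filter.eventually_imp_distrib_left]
    exact fun x _ y _ h => eventually_initialSegmentCode_ne h
  filter_upwards [this] with n hn x hx y hy hxy
  by_contra hne
  exact hn x hx y hy hne hxy

lemma LLe.getElem_eq {p q : LCond} (h : LLe p q) {i : ℕ} (hq : i < q.σ.length)
    (hp : i < p.σ.length) : p.σ[i] = q.σ[i] :=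
  (h.1.getElem hq).symm

/-- A condition of `𝕃` can be extended so that its sequence omits a value at a place where none of
its functions takes this value. -/
lemma LCond.exists_le_notMem (p : LCond) {i v : ℕ} (hi : p.σ.length ≤ i)
    (hv : ∀ g ∈ p.G, g i ≠ v) :
    ∃ q : LCond, LLe q p ∧ ∃ h : i < q.σ.length, v ∉ q.σ[i] := by
  classical
  have hslot : ∀ j, p.σ.length ≤ j → ∃ s : Finset ℕ, s.card = j + 1 ∧
      (∀ g ∈ p.G, g j ∈ s) ∧ (j = i → v ∉ s) := by
    intro j hj
    have hcard : (p.G.image fun g => g j).card ≤ j + 1 :=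
      Finset.card_image_le.trans (p.hG.trans (by omega))
    obtain ⟨t, ht, htcard⟩ := (Set.infinite_univ.sdiff (Finset.finite_toSet
      (insert v (p.G.image fun g => g j)))).exists_subset_card_eq
        (j + 1 - (p.G.image fun g => g j).card)
    have hnot : ∀ a ∈ t, a ∉ insert v (p.G.image fun g => g j) := fun a ha =>
      fun hmem => (ht ha).2 (Finset.mem_coe.2 hmem)
    refine ⟨(p.G.image fun g => g j) ∪ t, ?_, fun g hg => ?_, ?_⟩
    · rw [Finset.card_union_of_disjoint, htcard]
      · omega
      · exact Finset.disjoint_right.2 fun a ha hmem =>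
          hnot a ha (Finset.mem_insert_of_mem hmem)
    · exact Finset.mem_union_left _ (Finset.mem_image_of_mem (fun g : ℕ → ℕ => g j) hg)
    · rintro rfl hmem
      rcases Finset.mem_union.1 hmem with h | h
      · obtain ⟨g, hg, hgv⟩ := Finset.mem_image.1 h
        exact hv g hg hgv
      · exact hnot v h (Finset.mem_insert_self _ _)
  choose! s hscard hsmem hsv using hslot
  let τ := p.σ ++ (List.range' p.σ.length (i + 1 - p.σ.length)).map s
  have hlen : τ.length = i + 1 := by simp [τ]; omega
  have hτ : ∀ j (h : j < τ.length), p.σ.length ≤ j → τ[j] = s j := by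
    intro j h hj
    simp [τ, List.getElem_append_right hj, hj]
  refine ⟨⟨τ, p.G, fun j h => ?_, p.hG.trans (by omega)⟩,
    ⟨List.prefix_append _ _, subset_rfl, fun g hg j hj h => ?_⟩, by simp [hlen], ?_⟩
  · rcases lt_or_ge j p.σ.length with hj | hj
    · simpa [τ, List.getElem_append_left hj] using p.hσ j hj
    · simpa [hτ j h hj] using hscard j hj
  · simpa [hτ j h hj] using hsmem j hj g hg
  · simpa [hτ i (by omega) hi] using hsv i hi rfl

/-- A condition whose sequence omits a value of `f` is incompatible with `LCond.single f`. -/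
lemma LCond.not_compatible_single {q : LCond} {f : ℕ → ℕ} {i : ℕ} (h : i < q.σ.length)
    (hf : f i ∉ q.σ[i]) : ¬ ∃ r : LCond, LLe r q ∧ LLe r (LCond.single f) := by
  rintro ⟨r, hrq, hrf⟩
  have hr : i < r.σ.length := h.trans_le hrq.1.length_le
  have hmem : f i ∈ r.σ[i] := hrf.2.2 f (by simp [LCond.single]) i (by simp [LCond.single]) hr
  exact hf (hrq.getElem_eq h hr ▸ hmem)

lemma uncountable_cantorSpace : Uncountable (ℕ → Bool) := by
  rw [← Cardinal.aleph0_lt_mk_iff]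
  simpa using Cardinal.cantor Cardinal.aleph0

instance inst_s12 : IsFiniteMeasure μC := by
  unfold μC; infer_instance

/-- There is no complete embedding of the localization partial order `𝕃` into the Amoeba
partial order `𝔸`: no map `e : 𝕃 → 𝔸` is order-preserving, preserves incompatibility, and
admits a reduction in `𝕃` of every condition of `𝔸`. -/
theorem no_complete_embedding_L_to_Amoeba :
    ¬ ∃ e : LCond → Amoeba,
      (∀ p' p : LCond, LLe p' p → AmoebaLe (e p') (e p)) ∧
      (∀ p' p : LCond, ¬ (∃ r : LCond, LLe r p' ∧ LLe r p) →
        ¬ ∃ C : Amoeba, AmoebaLe C (e p') ∧ AmoebaLe C (e p)) ∧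
      (∀ A : Amoeba, ∃ p : LCond, ∀ p' : LCond, LLe p' p →
        ∃ C : Amoeba, AmoebaLe C (e p') ∧ AmoebaLe C A) := by
  rintro ⟨e, -, hincomp, hred⟩
  have := uncountable_cantorSpace
  obtain ⟨U, hU, hUμ, hfam⟩ := exists_isOpen_measure_lt_forall_exists_finset μC
    (fun x : ℕ → Bool => (e (LCond.single (initialSegmentCode x))).1) (fun x => (e _).2.1)
    (1 / 2) (fun x => (e _).2.2)
  obtain ⟨p, hp⟩ := hred ⟨U, hU, hUμ⟩
  obtain ⟨F, hFcard, hFU⟩ := hfam (p.G.card + 1)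
  obtain ⟨i, hinj, hi⟩ := ((eventually_injOn_initialSegmentCode F).and
    (Filter.eventually_ge_atTop p.σ.length)).exists
  obtain ⟨v, hvF, hvG⟩ : ∃ v ∈ F.image (fun x => initialSegmentCode x i),
      v ∉ p.G.image (fun g => g i) := by
    refine Finset.exists_mem_notMem_of_card_lt_card (Finset.card_image_le.trans_lt ?_)
    rw [Finset.card_image_of_injOn hinj]
    omega
  obtain ⟨x, hxF, rfl⟩ := Finset.mem_image.1 hvF
  obtain ⟨q, hqp, hiq, hq⟩ := p.exists_le_notMem hi
    fun g hg hgx => hvG (Finset.mem_image.2 ⟨g, hg, hgx⟩)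
  obtain ⟨C, hCq, hCU⟩ := hp q hqp
  exact hincomp q (LCond.single (initialSegmentCode x)) (LCond.not_compatible_single hiq hq)
    ⟨C, hCq, (hFU x hxF).trans hCU⟩

end
end
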